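/- Suppose (y, r*) → x → h is a Markov chain, r* is independent of y, and α, β ≥ 0. Then α[−I(h; x) + β I(r*; h)] ≤ −α(1−β) I(h; x) − αβ I(h; y). -/

import Mathlib

open Finset

/-- Pushforward of a mass function `p` on a finite sample space along `f`. -/
noncomputable def pmap {Ω B : Type*} [Fintype Ω] [DecidableEq B] (p : Ω → ℝ) (f : Ω → B) : B → ℝ :=
  fun b => ∑ ω, if f ω = b then p ω else 0

/-- Shannon entropy of a mass function on a finite alphabet (natural log). -/
noncomputable def ent {A : Type*} [Fintype A] (p : A → ℝ) : ℝ :=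
  ∑ a, -(p a * Real.log (p a))

/-- Mutual information `I(f ; g)` of two discrete random variables `f, g` on (Ω, p). -/
noncomputable def MI {Ω A B : Type*} [Fintype Ω] [Fintype A] [Fintype B]
    [DecidableEq A] [DecidableEq B] (p : Ω → ℝ) (f : Ω → A) (g : Ω → B) : ℝ :=
  ent (pmap p f) + ent (pmap p g) - ent (pmap p (fun ω => (f ω, g ω)))

/-- Conditional entropy `H(f | g)`. -/
noncomputable def condEnt {Ω A B : Type*} [Fintype Ω] [Fintype A] [Fintype B]
    [DecidableEq A] [DecidableEq B] (p : Ω → ℝ) (f : Ω → A) (g : Ω → B) : ℝ :=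
  ent (pmap p (fun ω => (f ω, g ω))) - ent (pmap p g)

/-- Conditional mutual information `I(f ; g | k) = H(g | k) - H(g | f, k)`. -/
noncomputable def condMI {Ω A B C : Type*} [Fintype Ω] [Fintype A] [Fintype B] [Fintype C]
    [DecidableEq A] [DecidableEq B] [DecidableEq C]
    (p : Ω → ℝ) (f : Ω → A) (g : Ω → B) (k : Ω → C) : ℝ :=
  condEnt p g k - condEnt p g (fun ω => (f ω, k ω))

/-- `p` is a probability mass function. -/
def IsPMF {Ω : Type*} [Fintype Ω] (p : Ω → ℝ) : Prop :=
  (∀ ω, 0 ≤ p ω) ∧ ∑ ω, p ω = 1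

/-- Conditional independence of `f` and `g` given `k` under `p`
(the Markov chain `f → k → g`). -/
def CondIndep {Ω A B C : Type*} [Fintype Ω] [DecidableEq A] [DecidableEq B] [DecidableEq C]
    (p : Ω → ℝ) (f : Ω → A) (g : Ω → B) (k : Ω → C) : Prop :=
  ∀ a b c, pmap p (fun ω => (f ω, g ω, k ω)) (a, b, c) * pmap p k c =
    pmap p (fun ω => (f ω, k ω)) (a, c) * pmap p (fun ω => (g ω, k ω)) (b, c)

/-- Independence of `f` and `g` under `p`. -/
def Indep {Ω A B : Type*} [Fintype Ω] [DecidableEq A] [DecidableEq B]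
    (p : Ω → ℝ) (f : Ω → A) (g : Ω → B) : Prop :=
  ∀ a b, pmap p (fun ω => (f ω, g ω)) (a, b) = pmap p f a * pmap p g b

section PushforwardLemmas

variable {Ω A B : Type*} [Fintype Ω] [DecidableEq A] [DecidableEq B] {p : Ω → ℝ}

theorem pmap_nonneg (hp : ∀ ω, 0 ≤ p ω) (f : Ω → A) (a : A) : 0 ≤ pmap p f a :=
  Finset.sum_nonneg fun ω _ => by split_ifs <;> simp [hp ω]

theorem pmap_apply_pos (hp : ∀ ω, 0 ≤ p ω) (f : Ω → A) {ω : Ω} (hω : 0 < p ω) :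
    0 < pmap p f (f ω) := by
  refine Finset.sum_pos' (fun ω' _ => ?_) ⟨ω, Finset.mem_univ ω, by simpa using hω⟩
  split_ifs <;> simp [hp ω']

theorem pmap_apply_of_injective (p : Ω → ℝ) {f : Ω → A} (hf : Function.Injective f) (ω : Ω) :
    pmap p f (f ω) = p ω := by
  unfold pmap
  rw [Finset.sum_eq_single ω (fun b _ hb => if_neg (hf.ne hb)) (by simp), if_pos rfl]

theorem sum_pmap [Fintype A] (p : Ω → ℝ) (f : Ω → A) : ∑ a, pmap p f a = ∑ ω, p ω := by
  unfold pmap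
  rw [Finset.sum_comm]
  simp

theorem sum_pmap_prodMk_right [Fintype B] (p : Ω → ℝ) (f : Ω → A) (g : Ω → B) (a : A) :
    ∑ b, pmap p (fun ω => (f ω, g ω)) (a, b) = pmap p f a := by
  unfold pmap
  rw [Finset.sum_comm]
  refine Finset.sum_congr rfl fun ω _ => ?_
  by_cases h : f ω = a <;> simp [h]

theorem sum_pmap_prodMk_left [Fintype A] (p : Ω → ℝ) (f : Ω → A) (g : Ω → B) (b : B) :
    ∑ a, pmap p (fun ω => (f ω, g ω)) (a, b) = pmap p g b := by
  unfold pmap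
  rw [Finset.sum_comm]
  refine Finset.sum_congr rfl fun ω _ => ?_
  by_cases h : g ω = b <;> simp [h]

theorem pmap_prodMk_swap (p : Ω → ℝ) (f : Ω → A) (g : Ω → B) (a : A) (b : B) :
    pmap p (fun ω => (f ω, g ω)) (a, b) = pmap p (fun ω => (g ω, f ω)) (b, a) := by
  unfold pmap
  simp only [Prod.mk.injEq, and_comm]

theorem ent_pmap [Fintype A] (p : Ω → ℝ) (f : Ω → A) :
    ent (pmap p f) = ∑ ω, -(p ω * Real.log (pmap p f (f ω))) := by
  have h (a : A) : -(pmap p f a * Real.log (pmap p f a)) =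
      ∑ ω, if f ω = a then -(p ω * Real.log (pmap p f (f ω))) else 0 := by
    nth_rewrite 1 [pmap]
    rw [Finset.sum_mul, ← Finset.sum_neg_distrib]
    refine Finset.sum_congr rfl fun ω _ => ?_
    split_ifs with hω
    · rw [hω]
    · simp
  unfold ent
  simp_rw [h]
  rw [Finset.sum_comm]
  simp

theorem MI_eq_sum [Fintype A] [Fintype B] (p : Ω → ℝ) (f : Ω → A) (g : Ω → B) :
    MI p f g = ∑ ω, p ω * (Real.log (pmap p (fun ω => (f ω, g ω)) (f ω, g ω)) -
      Real.log (pmap p f (f ω)) - Real.log (pmap p g (g ω))) := by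
  rw [MI, ent_pmap, ent_pmap, ent_pmap, ← Finset.sum_add_distrib, ← Finset.sum_sub_distrib]
  exact Finset.sum_congr rfl fun ω _ => by ring

end PushforwardLemmas

theorem sub_le_mul_log_sub_log {a b : ℝ} (ha : 0 < a) (hb : 0 < b) :
    a - b ≤ a * (Real.log a - Real.log b) := by
  have h := Real.log_le_sub_one_of_pos (div_pos hb ha)
  rw [Real.log_div hb.ne' ha.ne'] at h
  have h' := mul_le_mul_of_nonneg_left h ha.le
  rw [mul_sub, mul_sub, mul_div_cancel₀ _ ha.ne'] at h'
  linarith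

/-- If `(y, r) → x → h` is a Markov chain and `r` is independent of `y`, then
`I(r ; h) + I(h ; y) ≤ I(h ; x)`. -/
theorem MI_add_MI_le_MI {Y R X H : Type*} [Fintype Y] [Fintype R] [Fintype X] [Fintype H]
    [DecidableEq Y] [DecidableEq R] [DecidableEq X] [DecidableEq H]
    (p : Y × R × X × H → ℝ) (hp : IsPMF p)
    (hmarkov : CondIndep p (fun ω => ω.2.2.2) (fun ω => (ω.1, ω.2.1)) (fun ω => ω.2.2.1))
    (hindep : Indep p (fun ω => ω.2.1) (fun ω => ω.1)) :
    MI p (fun ω => ω.2.1) (fun ω => ω.2.2.2) + MI p (fun ω => ω.2.2.2) (fun ω => ω.1) ≤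
      MI p (fun ω => ω.2.2.2) (fun ω => ω.2.2.1) := by
  obtain ⟨hp0, hp1⟩ := hp
  let q : Y × R × X × H → ℝ := fun ω =>
    pmap p (fun ω => ((ω.1, ω.2.1), ω.2.2.1)) ((ω.1, ω.2.1), ω.2.2.1) /
        (pmap p (fun ω => ω.2.1) ω.2.1 * pmap p (fun ω => ω.1) ω.1) *
      (pmap p (fun ω => (ω.2.1, ω.2.2.2)) (ω.2.1, ω.2.2.2) *
        pmap p (fun ω => (ω.2.2.2, ω.1)) (ω.2.2.2, ω.1) / pmap p (fun ω => ω.2.2.2) ω.2.2.2)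
  have hq0 (ω) : 0 ≤ q ω :=
    mul_nonneg (div_nonneg (pmap_nonneg hp0 _ _)
        (mul_nonneg (pmap_nonneg hp0 _ _) (pmap_nonneg hp0 _ _)))
      (div_nonneg (mul_nonneg (pmap_nonneg hp0 _ _) (pmap_nonneg hp0 _ _))
        (pmap_nonneg hp0 _ _))
  have hsum_x (y : Y) (r : R) : ∑ x, pmap p (fun ω => ((ω.1, ω.2.1), ω.2.2.1)) ((y, r), x) =
      pmap p (fun ω => ω.2.1) r * pmap p (fun ω => ω.1) y := by
    rw [← hindep r y, pmap_prodMk_swap]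
    exact sum_pmap_prodMk_right p (fun ω => (ω.1, ω.2.1)) (fun ω => ω.2.2.1) (y, r)
  have hsum_h (h : H) : ∑ y, ∑ r, pmap p (fun ω => (ω.2.1, ω.2.2.2)) (r, h) *
      pmap p (fun ω => (ω.2.2.2, ω.1)) (h, y) / pmap p (fun ω => ω.2.2.2) h =
        pmap p (fun ω => ω.2.2.2) h := by
    simp_rw [← Finset.sum_div, ← Finset.sum_mul, ← Finset.mul_sum]
    rw [sum_pmap_prodMk_left p (fun ω => ω.2.1) (fun ω => ω.2.2.2),
      sum_pmap_prodMk_right p (fun ω => ω.2.2.2) (fun ω => ω.1), mul_self_div_self]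
  have hq1 : ∑ ω, q ω ≤ 1 := by
    calc ∑ ω, q ω
        = ∑ y, ∑ r, (∑ x, pmap p (fun ω => ((ω.1, ω.2.1), ω.2.2.1)) ((y, r), x)) /
            (pmap p (fun ω => ω.2.1) r * pmap p (fun ω => ω.1) y) *
          ∑ h, pmap p (fun ω => (ω.2.1, ω.2.2.2)) (r, h) *
            pmap p (fun ω => (ω.2.2.2, ω.1)) (h, y) / pmap p (fun ω => ω.2.2.2) h := by
          simp_rw [Finset.sum_div, Finset.sum_mul_sum, Fintype.sum_prod_type, q]
      _ ≤ ∑ y, ∑ r, ∑ h, pmap p (fun ω => (ω.2.1, ω.2.2.2)) (r, h) *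
            pmap p (fun ω => (ω.2.2.2, ω.1)) (h, y) / pmap p (fun ω => ω.2.2.2) h := by
          refine Finset.sum_le_sum fun y _ => Finset.sum_le_sum fun r _ => ?_
          rw [hsum_x]
          refine mul_le_of_le_one_left (Finset.sum_nonneg fun h _ => ?_) (div_self_le_one _)
          exact div_nonneg (mul_nonneg (pmap_nonneg hp0 _ _) (pmap_nonneg hp0 _ _))
            (pmap_nonneg hp0 _ _)
      _ = ∑ h, ∑ y, ∑ r, pmap p (fun ω => (ω.2.1, ω.2.2.2)) (r, h) *
            pmap p (fun ω => (ω.2.2.2, ω.1)) (h, y) / pmap p (fun ω => ω.2.2.2) h := by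
          exact (Finset.sum_congr rfl fun y _ => Finset.sum_comm).trans Finset.sum_comm
      _ = 1 := by
          simp_rw [hsum_h]
          rw [sum_pmap, hp1]
  rw [← sub_nonneg, MI_eq_sum, MI_eq_sum, MI_eq_sum, ← Finset.sum_add_distrib,
    ← Finset.sum_sub_distrib]
  calc (0 : ℝ) ≤ ∑ ω, (p ω - q ω) := by
        rw [Finset.sum_sub_distrib, hp1]
        linarith
    _ ≤ _ := by
      refine Finset.sum_le_sum fun ω _ => ?_
      rcases (hp0 ω).eq_or_lt with h0 | hpos
      · simpa [← h0] using hq0 ω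
      have hx := pmap_apply_pos hp0 (fun ω => ω.2.2.1) hpos
      have hh := pmap_apply_pos hp0 (fun ω => ω.2.2.2) hpos
      have hr := pmap_apply_pos hp0 (fun ω => ω.2.1) hpos
      have hy := pmap_apply_pos hp0 (fun ω => ω.1) hpos
      have hrh := pmap_apply_pos hp0 (fun ω => (ω.2.1, ω.2.2.2)) hpos
      have hhy := pmap_apply_pos hp0 (fun ω => (ω.2.2.2, ω.1)) hpos
      have hhx := pmap_apply_pos hp0 (fun ω => (ω.2.2.2, ω.2.2.1)) hpos
      have hyrx := pmap_apply_pos hp0 (fun ω => ((ω.1, ω.2.1), ω.2.2.1)) hpos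
      have hfactor : p ω * pmap p (fun ω => ω.2.2.1) ω.2.2.1 =
          pmap p (fun ω => (ω.2.2.2, ω.2.2.1)) (ω.2.2.2, ω.2.2.1) *
            pmap p (fun ω => ((ω.1, ω.2.1), ω.2.2.1)) ((ω.1, ω.2.1), ω.2.2.1) := by
        rw [← hmarkov ω.2.2.2 (ω.1, ω.2.1) ω.2.2.1]
        congr 1
        refine (pmap_apply_of_injective p (f := fun ω => (ω.2.2.2, (ω.1, ω.2.1), ω.2.2.1))
          ?_ ω).symm
        rintro ⟨_, _, _, _⟩ ⟨_, _, _, _⟩ h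
        simp_all
      have hlog := congrArg Real.log hfactor
      rw [Real.log_mul hpos.ne' hx.ne', Real.log_mul hhx.ne' hyrx.ne'] at hlog
      have hqpos : 0 < q ω := by positivity
      have hlogq : Real.log (q ω) = _ := Real.log_mul
        (div_pos hyrx (mul_pos hr hy)).ne' (div_pos (mul_pos hrh hhy) hh).ne'
      rw [Real.log_div hyrx.ne' (mul_pos hr hy).ne', Real.log_mul hr.ne' hy.ne',
        Real.log_div (mul_pos hrh hhy).ne' hh.ne', Real.log_mul hrh.ne' hhy.ne'] at hlogq
      refine (sub_le_mul_log_sub_log hpos hqpos).trans_eq ?_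
      rw [← mul_add, ← mul_sub]
      congr 1
      linarith

/-- Proposition 1: if `(y, r*) → x → h` is a Markov chain, `r* ⟂ y`,
and `α, β ≥ 0`, then `α[−I(h; x) + β I(r*; h)] ≤ −α(1−β) I(h; x) − αβ I(h; y)`. -/
theorem stmt4 {Y R X H : Type*} [Fintype Y] [Fintype R] [Fintype X] [Fintype H]
    [DecidableEq Y] [DecidableEq R] [DecidableEq X] [DecidableEq H]
    (p : Y × R × X × H → ℝ) (hp : IsPMF p)
    (hmarkov : CondIndep p (fun ω => ω.2.2.2) (fun ω => (ω.1, ω.2.1)) (fun ω => ω.2.2.1))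
    (hindep : Indep p (fun ω => ω.2.1) (fun ω => ω.1))
    (α β : ℝ) (hα : 0 ≤ α) (hβ : 0 ≤ β) :
    α * (-(MI p (fun ω => ω.2.2.2) (fun ω => ω.2.2.1)) +
        β * MI p (fun ω => ω.2.1) (fun ω => ω.2.2.2)) ≤
      -(α * (1 - β)) * MI p (fun ω => ω.2.2.2) (fun ω => ω.2.2.1) -
        α * β * MI p (fun ω => ω.2.2.2) (fun ω => ω.1) := by
  have h := mul_le_mul_of_nonneg_left (MI_add_MI_le_MI p hp hmarkov hindep) (mul_nonneg hα hβ)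
  linarith
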